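/- Let L be a complete lattice and let c : L → L satisfy: c is antitone, c(⊥) = ⊤, and x ⊓ c(x) = ⊥ for all x ∈ L. Let E be a bounded right-continuous spectral family in L and let 𝔅 be a quasipoint of L. Then sSup {λ ∈ ℝ | c(E_λ) ∈ 𝔅} ≤ sInf {λ ∈ ℝ | E_λ ∈ 𝔅}; that is, the antonymous function of the complement family λ ↦ c(E_λ) is everywhere less than or equal to the observable function of E. -/

import Mathlib

/-- A dual ideal in a complete lattice. -/
def IsDualIdeal {L : Type*} [CompleteLattice L] (D : Set L) : Prop :=
  D.Nonempty ∧ ⊥ ∉ D ∧ (∀ a ∈ D, ∀ b ∈ D, a ⊓ b ∈ D) ∧ ∀ a ∈ D, ∀ b : L, a ≤ b → b ∈ D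

/-- A quasipoint: a maximal dual ideal. -/
def IsQuasipoint {L : Type*} [CompleteLattice L] (D : Set L) : Prop :=
  IsDualIdeal D ∧ ∀ D' : Set L, IsDualIdeal D' → D ⊆ D' → D' = D

/-- A bounded right-continuous spectral family in a complete lattice. -/
def IsBoundedRightContinuousSpectralFamily {L : Type*} [CompleteLattice L] (E : ℝ → L) : Prop :=
  Monotone E ∧ (∀ l : ℝ, E l = ⨅ μ, ⨅ _ : l < μ, E μ) ∧
    ∃ a b : ℝ, a ≤ b ∧ (∀ l : ℝ, l < a → E l = ⊥) ∧ ∀ l : ℝ, b < l → E l = ⊤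

theorem IsDualIdeal.top_mem {L : Type*} [CompleteLattice L] {D : Set L} (hD : IsDualIdeal D) :
    ⊤ ∈ D := by
  obtain ⟨⟨x, hx⟩, -, -, hup⟩ := hD
  exact hup x hx ⊤ le_top

theorem IsDualIdeal.notMem_of_inf_eq_bot {L : Type*} [CompleteLattice L] {D : Set L}
    (hD : IsDualIdeal D) {x y : L} (hx : x ∈ D) (hxy : x ⊓ y = ⊥) : y ∉ D :=
  fun hy ↦ hD.2.1 (hxy ▸ hD.2.2.1 x hx y hy)

/-- For a complement-like map `c` (antitone, `c ⊥ = ⊤`, `x ⊓ c x = ⊥`), a bounded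
right-continuous spectral family `E` and a quasipoint `𝔅`, the antonymous function
of the complement family is dominated by the observable function of `E`:
`sSup {λ | c (E λ) ∈ 𝔅} ≤ sInf {λ | E λ ∈ 𝔅}`. -/
theorem antonymous_stmt8 {L : Type*} [CompleteLattice L]
    (c : L → L) (hc_anti : Antitone c) (hc_bot : c (⊥ : L) = ⊤)
    (hc_meet : ∀ x : L, x ⊓ c x = ⊥)
    (E : ℝ → L) (hE : IsBoundedRightContinuousSpectralFamily E)
    (B : Set L) (hB : IsQuasipoint B) :
    sSup {l : ℝ | c (E l) ∈ B} ≤ sInf {l : ℝ | E l ∈ B} := by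
  obtain ⟨hmono, -, a, b, -, ha, hb⟩ := hE
  have hD := hB.1
  have hne : {l : ℝ | c (E l) ∈ B}.Nonempty :=
    ⟨a - 1, by simpa [ha (a - 1) (by linarith), hc_bot] using hD.top_mem⟩
  have hne' : {l : ℝ | E l ∈ B}.Nonempty :=
    ⟨b + 1, by simpa [hb (b + 1) (by linarith)] using hD.top_mem⟩
  refine csSup_le hne fun l hl ↦ le_csInf hne' fun m hm ↦ ?_
  by_contra! hml
  have hmem : E l ∈ B := hD.2.2.2 _ hm _ (hmono hml.le)
  exact hD.notMem_of_inf_eq_bot hmem (hc_meet _) hl
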